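/- arXiv:2601.19388 — 7 statements merged into one kernel-verified Lean document; each statement's English description precedes it below -/
import Mathlib

section
/- Let M be a feasible schedule for N agents of horizon T on a graph G, let i be an agent, and let 0 ≤ a < b ≤ T with M_i(a) = M_i(b) = x. Let M' be the schedule obtained from M by replacing M_i with the collapse of M_i on [a,b] (all other agents' trajectories unchanged). Then M' is G-valid and has no edge collisions, and M' is feasible if and only if for every agent j ≠ i and every t with a < t < b, M_j(t) ≠ x. In other words, a single collapse can only create vertex collisions, and it creates one exactly when some other agent occupies the collapsed vertex x at a timestep strictly inside [a,b]. -/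
/-- The cost of a trajectory `π : ℕ → V` of horizon `T`: the number of timesteps
`t < T` with `π t ≠ π (t+1)`. -/
noncomputable def cost {V : Type*} (π : ℕ → V) (T : ℕ) : ℕ :=
  {t | t < T ∧ π t ≠ π (t + 1)}.ncard

/-- The collapse of the trajectory `π` on the interval `[a, b]`:
all positions in `[a, b]` are rewritten to `π a`, other positions are unchanged. -/
def collapse {V : Type*} (π : ℕ → V) (a b : ℕ) : ℕ → V :=
  fun t => if a ≤ t ∧ t ≤ b then π a else π t

/-- One collapse step on trajectories of horizon `T`: `π'` is obtained from `π` by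
collapsing a closed subwalk `[a, b]` with `a < b ≤ T` and `π a = π b`. -/
def CollapseStep {V : Type*} (T : ℕ) (π π' : ℕ → V) : Prop :=
  ∃ a b, a < b ∧ b ≤ T ∧ π a = π b ∧ π' = collapse π a b

/-- A schedule `M : ι → ℕ → V` is `G`-valid up to horizon `T` if every consecutive
pair of positions of every agent is equal (waiting) or joined by an edge of `G`. -/
def GValid {V ι : Type*} (G : SimpleGraph V) (T : ℕ) (M : ι → ℕ → V) : Prop :=
  ∀ i, ∀ t < T, M i t = M i (t + 1) ∨ G.Adj (M i t) (M i (t + 1))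

/-- No two distinct agents occupy the same vertex at the same timestep `t ≤ T`. -/
def NoVertexCollision {V ι : Type*} (T : ℕ) (M : ι → ℕ → V) : Prop :=
  ∀ i j, i ≠ j → ∀ t ≤ T, M i t ≠ M j t

/-- No two distinct agents traverse the same edge in opposite directions:
there are no `i ≠ j` and `t < T` with `M i t = M j (t+1)`, `M i (t+1) = M j t` and
`M j t ≠ M i t`. -/
def NoEdgeCollision {V ι : Type*} (T : ℕ) (M : ι → ℕ → V) : Prop :=
  ∀ i j, i ≠ j → ∀ t < T,
    ¬(M i t = M j (t + 1) ∧ M i (t + 1) = M j t ∧ M j t ≠ M i t)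

/-- A schedule is feasible if it is `G`-valid and has no vertex and no edge collisions. -/
def Feasible {V ι : Type*} (G : SimpleGraph V) (T : ℕ) (M : ι → ℕ → V) : Prop :=
  GValid G T M ∧ NoVertexCollision T M ∧ NoEdgeCollision T M

/-- The cost of a schedule: the sum of the costs of the agents' trajectories. -/
noncomputable def scheduleCost {V ι : Type*} [Fintype ι] (M : ι → ℕ → V) (T : ℕ) : ℕ :=
  ∑ i, cost (M i) T

/-- A collapsed trajectory either waits or makes the same move as the original one. -/
theorem collapse_eq_succ_or_eq {V : Type*} {π : ℕ → V} {a b : ℕ} (h : π a = π b) (t : ℕ) :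
    collapse π a b t = collapse π a b (t + 1) ∨
      collapse π a b t = π t ∧ collapse π a b (t + 1) = π (t + 1) := by
  unfold collapse
  rcases lt_trichotomy (t + 1) a with h1 | h1 | h1
  · grind
  · grind
  · rcases lt_trichotomy t b with h2 | h2 | h2 <;> grind

theorem GValid.update_collapse {V ι : Type*} [DecidableEq ι] {G : SimpleGraph V} {T : ℕ}
    {M : ι → ℕ → V} (hM : GValid G T M) {i : ι} {a b : ℕ} (h : M i a = M i b) :
    GValid G T (Function.update M i (collapse (M i) a b)) := by
  intro j t ht
  rcases eq_or_ne j i with rfl | hj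
  · rw [Function.update_self]
    rcases collapse_eq_succ_or_eq h t with hw | ⟨h1, h2⟩
    · exact .inl hw
    · rw [h1, h2]
      exact hM j t ht
  · rw [Function.update_of_ne hj]
    exact hM j t ht

theorem NoEdgeCollision.update_collapse {V ι : Type*} [DecidableEq ι] {T : ℕ}
    {M : ι → ℕ → V} (hM : NoEdgeCollision T M) {i : ι} {a b : ℕ} (h : M i a = M i b) :
    NoEdgeCollision T (Function.update M i (collapse (M i) a b)) := by
  intro j k hjk t ht
  have hjk' := hM j k hjk t ht
  have hc := collapse_eq_succ_or_eq h t
  rcases eq_or_ne j i with rfl | hj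
  · rw [Function.update_self, Function.update_of_ne hjk.symm]
    grind
  · rw [Function.update_of_ne hj]
    rcases eq_or_ne k i with rfl | hk
    · rw [Function.update_self]
      grind
    · rwa [Function.update_of_ne hk]

theorem NoVertexCollision.update_collapse_iff {V ι : Type*} [DecidableEq ι] {T : ℕ}
    {M : ι → ℕ → V} (hM : NoVertexCollision T M) {i : ι} {a b : ℕ} (hbT : b ≤ T)
    (h : M i a = M i b) :
    NoVertexCollision T (Function.update M i (collapse (M i) a b)) ↔
      ∀ j, j ≠ i → ∀ t, a < t → t < b → M j t ≠ M i a := by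
  constructor
  · intro hV j hj t hat htb
    have := hV j i hj t (htb.le.trans hbT)
    rwa [Function.update_of_ne hj, Function.update_self, collapse,
      if_pos ⟨hat.le, htb.le⟩] at this
  · intro hx
    have key : ∀ j, j ≠ i → ∀ t ≤ T, M j t ≠ collapse (M i) a b t := by
      intro j hj t ht
      have hv := hM j i hj t ht
      have hxt := hx j hj t
      unfold collapse
      grind
    intro j k hjk t ht
    rcases eq_or_ne j i with rfl | hj
    · rw [Function.update_self, Function.update_of_ne hjk.symm]
      exact (key k hjk.symm t ht).symm
    · rw [Function.update_of_ne hj]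
      rcases eq_or_ne k i with rfl | hk
      · rw [Function.update_self]
        exact key j hj t ht
      · rw [Function.update_of_ne hk]
        exact hM j k hjk t ht

/-- applying a single collapse to one agent of a feasible schedule keeps
`G`-validity and absence of edge collisions; the result is feasible iff no other agent
occupies the collapsed vertex `x` at a timestep strictly inside `[a, b]`. -/
theorem stmt_4 {V : Type*} (G : SimpleGraph V) (N T : ℕ)
    (M : Fin N → ℕ → V) (hM : Feasible G T M)
    (i : Fin N) (a b : ℕ) (hab : a < b) (hbT : b ≤ T)
    (x : V) (hxa : M i a = x) (hxb : M i b = x) :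
    GValid G T (Function.update M i (collapse (M i) a b)) ∧
    NoEdgeCollision T (Function.update M i (collapse (M i) a b)) ∧
    (Feasible G T (Function.update M i (collapse (M i) a b)) ↔
      ∀ j, j ≠ i → ∀ t, a < t → t < b → M j t ≠ x) := by
  subst hxa
  have hG := hM.1.update_collapse hxb.symm
  have hE := hM.2.2.update_collapse hxb.symm
  have hV := hM.2.1.update_collapse_iff hbT hxb.symm
  exact ⟨hG, hE, fun hF => hV.1 hF.2.1, fun hx => ⟨hG, hV.2 hx, hE⟩⟩
end

section
/- Let M be a feasible schedule for N agents of horizon T on a graph G, let i be an agent, and let t be a timestep with 0 < t < T such that M_i(t−1) = M_i(t+1) = A, M_i(t) ≠ A, and M_j(t) ≠ A for every agent j ≠ i. Let M' be the schedule obtained from M by setting M'_i(t) = A and leaving all other entries unchanged (the rewrite of the oscillation 'A B A' into 'A A A'). Then M' is feasible and cost(M') = cost(M) − 2. -/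
theorem cost_update_oscillation {V : Type*} (π : ℕ → V) {T s : ℕ} (hT : s + 1 < T)
    (hreturn : π (s + 2) = π s) (hleave : π (s + 1) ≠ π s) :
    cost (Function.update π (s + 1) (π s)) T + 2 = cost π T := by
  unfold cost
  have hsub : ({s, s + 1} : Set ℕ) ⊆ {r | r < T ∧ π r ≠ π (r + 1)} := by
    rintro r (rfl | rfl)
    · exact ⟨by omega, hleave.symm⟩
    · exact ⟨hT, by simpa [hreturn] using hleave⟩
  have hdiff : {r | r < T ∧ Function.update π (s + 1) (π s) r ≠
      Function.update π (s + 1) (π s) (r + 1)} =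
      {r | r < T ∧ π r ≠ π (r + 1)} \ {s, s + 1} := by
    ext r
    by_cases hr : r = s
    · simp [hr]
    by_cases hr' : r = s + 1
    · simp [hr', hreturn]
    · simp [hr, hr']
  have hfin : {r | r < T ∧ π r ≠ π (r + 1)}.Finite :=
    (Set.finite_lt_nat T).subset fun _ h => h.1
  rw [hdiff, ← Set.ncard_pair (show s ≠ s + 1 by omega)]
  exact Set.ncard_sdiff_add_ncard_of_subset hsub hfin

theorem scheduleCost_update {V ι : Type*} [Fintype ι] [DecidableEq ι] (M : ι → ℕ → V)
    (i : ι) (π : ℕ → V) (T : ℕ) :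
    scheduleCost (Function.update M i π) T + cost (M i) T = scheduleCost M T + cost π T := by
  unfold scheduleCost
  rw [Fintype.sum_eq_add_sum_compl i, Fintype.sum_eq_add_sum_compl i (fun j => cost (M j) T)]
  have hrest : ∑ j ∈ {i}ᶜ, cost (Function.update M i π j) T = ∑ j ∈ {i}ᶜ, cost (M j) T :=
    Finset.sum_congr rfl fun j hj => by
      rw [Function.update_of_ne (by simpa using hj)]
  rw [hrest, Function.update_self]
  ring

theorem feasible_update_oscillation {V ι : Type*} [DecidableEq ι] {G : SimpleGraph V}
    {T s : ℕ} {M : ι → ℕ → V} (hM : Feasible G T M) {i : ι}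
    (hreturn : M i (s + 2) = M i s) (hothers : ∀ j, j ≠ i → M j (s + 1) ≠ M i s) :
    Feasible G T (Function.update M i (Function.update (M i) (s + 1) (M i s))) := by
  obtain ⟨hvalid, hvertex, hedge⟩ := hM
  have happly (j : ι) (r : ℕ) :
      Function.update M i (Function.update (M i) (s + 1) (M i s)) j r =
        if j = i ∧ r = s + 1 then M i s else M j r := by
    by_cases hj : j = i
    · subst hj
      simp [Function.update_apply]
    · simp [hj]
  refine ⟨?_, ?_, ?_⟩
  · intro j r hr
    have := hvalid j r hr
    simp only [happly]
    grind
  · intro j k hjk r hr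
    have := hvertex j k hjk r hr
    simp only [happly]
    grind
  · intro j k hjk r hr
    have := hedge j k hjk r hr
    have := hvertex j k hjk r hr.le
    have := hvertex j k hjk (r + 1) hr
    simp only [happly]
    grind

/-- rewriting an oscillation `A B A` of agent `i` into `A A A`, when no
other agent occupies `A` at the middle timestep, keeps the schedule feasible and
decreases its cost by exactly `2`. -/
theorem stmt_6 {V : Type*} (G : SimpleGraph V) (N T : ℕ)
    (M : Fin N → ℕ → V) (hM : Feasible G T M)
    (i : Fin N) (t : ℕ) (h0 : 0 < t) (hT : t < T) (A : V)
    (hprev : M i (t - 1) = A) (hnext : M i (t + 1) = A) (hcur : M i t ≠ A)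
    (hothers : ∀ j, j ≠ i → M j t ≠ A) :
    Feasible G T (Function.update M i (Function.update (M i) t A)) ∧
    scheduleCost (Function.update M i (Function.update (M i) t A)) T
      = scheduleCost M T - 2 := by
  obtain ⟨s, rfl⟩ : ∃ s, t = s + 1 := ⟨t - 1, by omega⟩
  obtain rfl : M i s = A := by simpa using hprev
  refine ⟨feasible_update_oscillation hM hnext hothers, ?_⟩
  have hagent := cost_update_oscillation (M i) hT hnext hcur
  have htotal := scheduleCost_update M i (Function.update (M i) (s + 1) (M i s)) T
  omega
end

section
/- Let α, β, γ, x, y be five pairwise distinct elements of V, let 0 ≤ Θ and Θ + 6 ≤ T, and let σ : {0,…,T} → V be the edge-agent gadget trajectory with σ(t) = α for t ≤ Θ, (σ(Θ), σ(Θ+1), …, σ(Θ+6)) = (α, x, β, γ, α, y, β), and σ(t) = β for t ≥ Θ+6. Then cost(σ) = 6, and every trajectory obtainable from σ by a sequence of collapses has cost at least 2; equivalently, no sequence of collapses can save more than 4 of the 6 moves of σ. -/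
lemma collapse_zero {V : Type*} (π : ℕ → V) (a b : ℕ) : collapse π a b 0 = π 0 := by
  unfold collapse
  grind

lemma collapse_horizon {V : Type*} {π : ℕ → V} {a b T : ℕ} (hb : b ≤ T) (hab : π a = π b) :
    collapse π a b T = π T := by
  unfold collapse
  grind

/-- A collapse creates no new move. -/
lemma collapse_step {V : Type*} {π : ℕ → V} {a b : ℕ} (hab : π a = π b) (t : ℕ) :
    collapse π a b t = collapse π a b (t + 1) ∨
      (collapse π a b t = π t ∧ collapse π a b (t + 1) = π (t + 1)) := by
  unfold collapse
  grind

lemma exists_first_move {V : Type*} {π : ℕ → V} {a b : ℕ} (hab : a ≤ b) (h : π a ≠ π b) :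
    ∃ t, a ≤ t ∧ t < b ∧ π t = π a ∧ π t ≠ π (t + 1) := by
  induction b, hab using Nat.le_induction with
  | base => exact absurd rfl h
  | succ n hn ih =>
    by_cases hπ : π a = π n
    · exact ⟨n, hn, n.lt_succ_self, hπ.symm, hπ ▸ h⟩
    · obtain ⟨t, hat, htn, ht⟩ := ih hπ
      exact ⟨t, hat, htn.trans n.lt_succ_self, ht⟩

lemma finite_moves {V : Type*} (π : ℕ → V) (T : ℕ) :
    {t | t < T ∧ π t ≠ π (t + 1)}.Finite :=
  (Set.finite_Iio T).subset fun _ ht => ht.1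

/-- A trajectory with distinct endpoints that never moves directly from its first to its
last position moves at least twice. -/
lemma two_le_cost {V : Type*} {π : ℕ → V} {T : ℕ} (hne : π 0 ≠ π T)
    (hdir : ∀ t, ¬(π t = π 0 ∧ π (t + 1) = π T)) : 2 ≤ cost π T := by
  obtain ⟨t, -, htT, ht0, ht⟩ := exists_first_move T.zero_le hne
  obtain ⟨s, hts, hsT, -, hs⟩ :=
    exists_first_move (Nat.succ_le_of_lt htT) fun h => hdir t ⟨ht0, h⟩
  have hlt : t < s := hts
  rw [cost, ← Set.ncard_pair hlt.ne]
  refine Set.ncard_le_ncard ?_ (finite_moves π T)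
  rintro u (rfl | rfl)
  exacts [⟨htT, ht⟩, ⟨hsT, hs⟩]

/-- Sequences of collapses preserve the endpoints, and create no move from `α` to `β`
if `α ≠ β`. -/
lemma reflTransGen_collapseStep_invariant {V : Type*} {α β : V} (hαβ : α ≠ β) {T : ℕ}
    {σ σ' : ℕ → V} (hσ : ∀ t, ¬(σ t = α ∧ σ (t + 1) = β))
    (h : Relation.ReflTransGen (CollapseStep T) σ σ') :
    σ' 0 = σ 0 ∧ σ' T = σ T ∧ ∀ t, ¬(σ' t = α ∧ σ' (t + 1) = β) := by
  induction h with
  | refl => exact ⟨rfl, rfl, hσ⟩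
  | tail _ hstep ih =>
    obtain ⟨a, b, -, hbT, hab, rfl⟩ := hstep
    refine ⟨(collapse_zero _ a b).trans ih.1, (collapse_horizon hbT hab).trans ih.2.1, ?_⟩
    rintro t ⟨hα, hβ⟩
    rcases collapse_step hab t with heq | ⟨h₀, h₁⟩
    · exact hαβ (hα.symm.trans (heq.trans hβ))
    · exact ih.2.2 t ⟨h₀.symm.trans hα, h₁.symm.trans hβ⟩

/-- the edge-agent gadget trajectory `σ` (= `α,…,α,x,β,γ,α,y,β,…,β`)
has cost 6, and every trajectory obtainable from it by a sequence of collapses has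
cost at least 2 (no sequence of collapses saves more than 4 of its 6 moves). -/
theorem stmt_8 {V : Type*} (α β γ x y : V)
    (hd : List.Pairwise (· ≠ ·) [α, β, γ, x, y])
    (Θ T : ℕ) (hΘT : Θ + 6 ≤ T) (σ : ℕ → V)
    (h1 : ∀ t ≤ Θ, σ t = α)
    (h2 : σ (Θ + 1) = x) (h3 : σ (Θ + 2) = β) (h4 : σ (Θ + 3) = γ)
    (h5 : σ (Θ + 4) = α) (h6 : σ (Θ + 5) = y)
    (h7 : ∀ t, Θ + 6 ≤ t → σ t = β) :
    cost σ T = 6 ∧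
    ∀ σ', Relation.ReflTransGen (CollapseStep T) σ σ' → 2 ≤ cost σ' T := by
  simp only [List.pairwise_cons, List.mem_cons, List.not_mem_nil, or_false, forall_eq_or_imp,
    forall_eq] at hd
  obtain ⟨⟨hαβ, hαγ, hαx, hαy⟩, ⟨hβγ, hβx, hβy⟩, -⟩ := hd
  have hcases (t : ℕ) : t + 1 ≤ Θ ∨ t = Θ ∨ t = Θ + 1 ∨ t = Θ + 2 ∨ t = Θ + 3 ∨ t = Θ + 4 ∨
      t = Θ + 5 ∨ Θ + 6 ≤ t := by omega
  have h0 : σ Θ = α := h1 Θ le_rfl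
  have h8 : σ (Θ + 6) = β := h7 _ le_rfl
  constructor
  · have hmoves : {t | t < T ∧ σ t ≠ σ (t + 1)} = ↑(Finset.Ico Θ (Θ + 6)) := by
      ext t
      simp only [Set.mem_ofPred_eq, Finset.coe_Ico, Set.mem_Ico]
      rcases hcases t with h | rfl | rfl | rfl | rfl | rfl | rfl | h <;> grind
    rw [cost, hmoves, Set.ncard_coe_finset, Nat.card_Ico, Nat.add_sub_cancel_left]
  · intro σ' hσ'
    have hdir : ∀ t, ¬(σ t = α ∧ σ (t + 1) = β) := by
      intro t
      rcases hcases t with h | rfl | rfl | rfl | rfl | rfl | rfl | h <;> grind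
    obtain ⟨hzero, hT, hdir'⟩ := reflTransGen_collapseStep_invariant hαβ hdir hσ'
    rw [h1 0 Θ.zero_le] at hzero
    rw [h7 T hΘT] at hT
    exact two_le_cost (by rwa [hzero, hT]) (by rwa [hzero, hT])
end

section
/- Let α, β, γ, x, y be five pairwise distinct elements of V, let 0 ≤ Θ and Θ + 6 ≤ T, and let σ : {0,…,T} → V be the edge-agent gadget trajectory with σ(t) = α for t ≤ Θ, (σ(Θ), σ(Θ+1), …, σ(Θ+6)) = (α, x, β, γ, α, y, β), and σ(t) = β for t ≥ Θ+6. Then every trajectory σ' obtainable from σ by a sequence of collapses satisfies σ'(Θ+1) = x or σ'(Θ+5) = y; that is, no sequence of collapses can simultaneously eliminate the visit to x at time Θ+1 and the visit to y at time Θ+5. -/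
/-- Collapsing an interval on which the trajectory is already constant changes nothing. -/
theorem collapse_eq_self {V : Type*} {π : ℕ → V} {a b : ℕ}
    (h : ∀ t, a ≤ t → t ≤ b → π t = π a) : collapse π a b = π := by
  funext t
  unfold collapse
  split_ifs with ht
  · exact (h t ht.1 ht.2).symm
  · rfl

/-- no sequence of collapses on the edge-agent gadget trajectory can
simultaneously eliminate the visit to `x` at time `Θ+1` and the visit to `y` at time
`Θ+5`. -/
theorem stmt_9 {V : Type*} (α β γ x y : V)
    (hd : List.Pairwise (· ≠ ·) [α, β, γ, x, y])
    (Θ T : ℕ) (hΘT : Θ + 6 ≤ T) (σ : ℕ → V)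
    (h1 : ∀ t ≤ Θ, σ t = α)
    (h2 : σ (Θ + 1) = x) (h3 : σ (Θ + 2) = β) (h4 : σ (Θ + 3) = γ)
    (h5 : σ (Θ + 4) = α) (h6 : σ (Θ + 5) = y)
    (h7 : ∀ t, Θ + 6 ≤ t → σ t = β) :
    ∀ σ', Relation.ReflTransGen (CollapseStep T) σ σ' →
      σ' (Θ + 1) = x ∨ σ' (Θ + 5) = y := by
  have hcases : ∀ t, t ≤ Θ ∨ t = Θ + 1 ∨ t = Θ + 2 ∨ t = Θ + 3 ∨ t = Θ + 4 ∨ t = Θ + 5 ∨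
      Θ + 6 ≤ t := by
    intro t; omega
  simp only [List.pairwise_cons, List.mem_cons, List.not_mem_nil, or_false, forall_eq_or_imp,
    forall_eq, ne_eq] at hd
  obtain ⟨⟨hαβ, hαγ, hαx, hαy⟩, ⟨hβγ, hβx, hβy⟩, ⟨hγx, hγy⟩, hxy, -⟩ := hd
  -- Only three trajectories are reachable: `σ`, and `σ` with one of its two loops removed.
  have hreach : ∀ σ', Relation.ReflTransGen (CollapseStep T) σ σ' →
      σ' = σ ∨ σ' = (fun t => if t ≤ Θ + 4 then α else σ t) ∨
        σ' = (fun t => if Θ + 2 ≤ t then β else σ t) := by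
    intro σ' hσ'
    induction hσ' with
    | refl => exact Or.inl rfl
    | tail _ hstep ih =>
      obtain ⟨a, b, hab, -, heq, rfl⟩ := hstep
      rcases ih with rfl | rfl | rfl
      · by_cases hα : a ≤ Θ ∧ b = Θ + 4
        · right; left
          funext t
          unfold collapse
          grind
        by_cases hβ : a = Θ + 2 ∧ Θ + 6 ≤ b
        · right; right
          funext t
          unfold collapse
          grind
        left
        apply collapse_eq_self
        have hconst : b ≤ Θ ∨ Θ + 6 ≤ a := by
          rcases hcases a with ha | rfl | rfl | rfl | rfl | rfl | ha <;>
          rcases hcases b with hb | rfl | rfl | rfl | rfl | rfl | hb <;> grind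
        grind
      · right; left
        apply collapse_eq_self
        have hconst : b ≤ Θ + 4 ∨ Θ + 6 ≤ a := by grind
        grind
      · right; right
        apply collapse_eq_self
        have hconst : b ≤ Θ ∨ Θ + 2 ≤ a := by grind
        grind
  intro σ' hσ'
  rcases hreach σ' hσ' with rfl | rfl | rfl
  · exact Or.inl h2
  · right; simpa using h6
  · left; simpa using h2
end

section
/- In the independent-set reduction with m ≥ 1 edges, the constructed input schedule M on the constructed graph G with horizon T = 7m − 1 is feasible: it is G-valid, has no vertex collisions, and has no edge collisions. -/
/-! ### The independent-set reduction

Given a finite simple graph `H = (U, F)` with `m ≥ 1` edges enumerated by `Fin m`,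
where edge `r` has endpoints `eu r` and `ev r`, we construct the MAPF instance of the
reduction: the vertex set `RV U m` (vertices `xv u`, `pv u` for `u : U` and
`av r`, `bv r`, `cv r` for `r : Fin m`, all pairwise distinct), the simple graph
`RG m eu ev`, the horizon `7*m - 1`, the vertex-agent trajectories `Atraj`,
the edge-agent trajectories `Btraj` (with block start `Θ_r = 7*r`), and the input
schedule `Msched` for the agents `U ⊕ Fin m`. -/

/-- Vertex set of the constructed MAPF instance. -/
abbrev RV (U : Type*) (m : ℕ) := (U ⊕ U) ⊕ (Fin m × Fin 3)

/-- The vertex `x_u`. -/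
def xv {U : Type*} {m : ℕ} (u : U) : RV U m := Sum.inl (Sum.inl u)

/-- The vertex `p_u`. -/
def pv {U : Type*} {m : ℕ} (u : U) : RV U m := Sum.inl (Sum.inr u)

/-- The vertex `a_{e_r}`. -/
def av {U : Type*} {m : ℕ} (r : Fin m) : RV U m := Sum.inr (r, 0)

/-- The vertex `b_{e_r}`. -/
def bv {U : Type*} {m : ℕ} (r : Fin m) : RV U m := Sum.inr (r, 1)

/-- The vertex `c_{e_r}`. -/
def cv {U : Type*} {m : ℕ} (r : Fin m) : RV U m := Sum.inr (r, 2)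

/-- The simple graph `G` of the constructed MAPF instance: edges `{x_u, p_u}` for each
`u`, and `{a_e, x_u}, {x_u, b_e}, {b_e, c_e}, {c_e, a_e}, {a_e, x_v}, {x_v, b_e}` for
each edge `e = (u, v)` of `H`. -/
def RG {U : Type*} (m : ℕ) (eu ev : Fin m → U) : SimpleGraph (RV U m) :=
  SimpleGraph.fromRel (fun w z =>
    (∃ u, w = xv u ∧ z = pv u) ∨
    (∃ r, (w = av r ∧ z = xv (eu r)) ∨ (w = xv (eu r) ∧ z = bv r) ∨
          (w = bv r ∧ z = cv r) ∨ (w = cv r ∧ z = av r) ∨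
          (w = av r ∧ z = xv (ev r)) ∨ (w = xv (ev r) ∧ z = bv r)))

/-- The vertex-agent trajectory `A_u`: at `x_u` at times `0` and `T = 7*m - 1`, at
`p_u` at all times strictly in between. -/
def Atraj {U : Type*} (m : ℕ) (u : U) : ℕ → RV U m :=
  fun t => if t = 0 then xv u else if t < 7 * m - 1 then pv u else xv u

/-- The edge-agent trajectory `B_{e_r}` with block start `Θ_r = 7*r`: it waits at
`a_{e_r}` until `Θ_r`, follows `(a_{e_r}, x_{u_r}, b_{e_r}, c_{e_r}, a_{e_r}, x_{v_r},
b_{e_r})` on `[Θ_r, Θ_r + 6]`, and waits at `b_{e_r}` afterwards. -/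
def Btraj {U : Type*} {m : ℕ} (eu ev : Fin m → U) (r : Fin m) : ℕ → RV U m :=
  fun t =>
    if t ≤ 7 * (r : ℕ) then av r
    else if t = 7 * (r : ℕ) + 1 then xv (eu r)
    else if t = 7 * (r : ℕ) + 2 then bv r
    else if t = 7 * (r : ℕ) + 3 then cv r
    else if t = 7 * (r : ℕ) + 4 then av r
    else if t = 7 * (r : ℕ) + 5 then xv (ev r)
    else bv r

/-- The constructed input schedule `M` for the agents `U ⊕ Fin m`. -/
def Msched {U : Type*} (m : ℕ) (eu ev : Fin m → U) : (U ⊕ Fin m) → ℕ → RV U m :=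
  Sum.elim (Atraj m) (Btraj eu ev)

theorem Atraj_eq_xv_or_pv {U : Type*} (m : ℕ) (u : U) (t : ℕ) :
    Atraj m u t = xv u ∨ Atraj m u t = pv u := by
  unfold Atraj
  split_ifs <;> simp

theorem time_of_Atraj_eq_xv {U : Type*} {m : ℕ} {u w : U} {t : ℕ}
    (h : Atraj m u t = xv w) : t = 0 ∨ 7 * m - 1 ≤ t := by
  unfold Atraj at h
  split_ifs at h with h₀ h₁
  · exact Or.inl h₀
  · simp [xv, pv] at h
  · exact Or.inr (not_lt.mp h₁)

theorem eq_of_Atraj_eq_Atraj {U : Type*} {m : ℕ} {u w : U} {t t' : ℕ}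
    (h : Atraj m u t = Atraj m w t') : u = w := by
  rcases Atraj_eq_xv_or_pv m u t with h₁ | h₁ <;>
    rcases Atraj_eq_xv_or_pv m w t' with h₂ | h₂ <;>
    simp_all [xv, pv]

/-- An edge-agent is at one of its own three vertices, or inside its block at some `x_u`. -/
theorem Btraj_eq_inr_or_xv {U : Type*} {m : ℕ} (eu ev : Fin m → U) (r : Fin m) (t : ℕ) :
    (∃ k, Btraj eu ev r t = Sum.inr (r, k)) ∨
      (∃ w, Btraj eu ev r t = xv w) ∧ 7 * (r : ℕ) + 1 ≤ t ∧ t ≤ 7 * (r : ℕ) + 5 := by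
  unfold Btraj
  split_ifs <;> first
    | exact Or.inl ⟨_, rfl⟩
    | exact Or.inr ⟨⟨_, rfl⟩, by omega, by omega⟩

theorem Btraj_ne_pv {U : Type*} {m : ℕ} (eu ev : Fin m → U) (r : Fin m) (t : ℕ) (w : U) :
    Btraj eu ev r t ≠ pv w := by
  rcases Btraj_eq_inr_or_xv eu ev r t with ⟨k, h⟩ | ⟨⟨w', h⟩, -⟩ <;> simp [h, xv, pv]

/-- An edge-agent moves only inside its block. -/
theorem Btraj_succ_eq_or_mem_block {U : Type*} {m : ℕ} (eu ev : Fin m → U) (r : Fin m)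
    (t : ℕ) : Btraj eu ev r t = Btraj eu ev r (t + 1) ∨
      7 * (r : ℕ) ≤ t ∧ t < 7 * (r : ℕ) + 6 := by
  by_cases h : 7 * (r : ℕ) ≤ t ∧ t < 7 * (r : ℕ) + 6
  · exact Or.inr h
  · left
    unfold Btraj
    split_ifs <;> first | rfl | omega

theorem Atraj_ne_Btraj {U : Type*} {m : ℕ} (eu ev : Fin m → U) (u : U) (r : Fin m) (t : ℕ) :
    Atraj m u t ≠ Btraj eu ev r t := by
  intro h
  rcases Btraj_eq_inr_or_xv eu ev r t with ⟨k, hk⟩ | ⟨⟨w, hw⟩, h₁, h₂⟩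
  · rcases Atraj_eq_xv_or_pv m u t with hA | hA <;> simp [hA, hk, xv, pv] at h
  · have := time_of_Atraj_eq_xv (h.trans hw)
    omega

theorem eq_of_Btraj_eq_Btraj {U : Type*} {m : ℕ} {eu ev : Fin m → U} {r s : Fin m} {t : ℕ}
    (h : Btraj eu ev r t = Btraj eu ev s t) : r = s := by
  rcases Btraj_eq_inr_or_xv eu ev r t with ⟨k, hk⟩ | ⟨⟨w, hw⟩, h₁, h₂⟩ <;>
    rcases Btraj_eq_inr_or_xv eu ev s t with ⟨l, hl⟩ | ⟨⟨z, hz⟩, h₃, h₄⟩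
  · rw [hk, hl] at h
    exact congrArg Prod.fst (Sum.inr.inj h)
  · simp [hk, hz, xv] at h
  · simp [hw, hl, xv] at h
  · omega

theorem Atraj_swap_Btraj_eq {U : Type*} {m : ℕ} {eu ev : Fin m → U} {u : U} {r : Fin m}
    {t : ℕ} (h₁ : Atraj m u t = Btraj eu ev r (t + 1))
    (h₂ : Atraj m u (t + 1) = Btraj eu ev r t) : Btraj eu ev r t = Atraj m u t := by
  have hx := (Atraj_eq_xv_or_pv m u t).resolve_right
    fun h => Btraj_ne_pv eu ev r (t + 1) u (h₁.symm.trans h)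
  have hx' := (Atraj_eq_xv_or_pv m u (t + 1)).resolve_right
    fun h => Btraj_ne_pv eu ev r t u (h₂.symm.trans h)
  rw [← h₂, hx, hx']

theorem gValid_Msched {U : Type*} (m : ℕ) (eu ev : Fin m → U) (T : ℕ) :
    GValid (RG m eu ev) T (Msched m eu ev) := by
  rintro (u | r) t -
  · have hadj : (RG m eu ev).Adj (xv u) (pv u) := by simp [RG, xv, pv]
    simp only [Msched, Sum.elim_inl]
    rcases Atraj_eq_xv_or_pv m u t with h | h <;>
      rcases Atraj_eq_xv_or_pv m u (t + 1) with h' | h' <;> rw [h, h']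
    exacts [Or.inl rfl, Or.inr hadj, Or.inr hadj.symm, Or.inl rfl]
  · simp only [Msched, Sum.elim_inr]
    refine (Btraj_succ_eq_or_mem_block eu ev r t).imp_right fun ⟨h₁, h₂⟩ => ?_
    obtain ⟨d, rfl⟩ := Nat.exists_eq_add_of_le h₁
    have hd : d < 6 := by omega
    interval_cases d <;> simp [Btraj, RG, xv, pv, av, bv, cv] <;> exact ⟨r, by simp⟩

theorem noVertexCollision_Msched {U : Type*} (m : ℕ) (eu ev : Fin m → U) (T : ℕ) :
    NoVertexCollision T (Msched m eu ev) := by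
  rintro (u | r) (w | s) hne t - h
  · exact hne (congrArg Sum.inl (eq_of_Atraj_eq_Atraj h))
  · exact Atraj_ne_Btraj eu ev u s t h
  · exact Atraj_ne_Btraj eu ev w r t h.symm
  · exact hne (congrArg Sum.inr (eq_of_Btraj_eq_Btraj h))

theorem noEdgeCollision_Msched {U : Type*} (m : ℕ) (eu ev : Fin m → U) (T : ℕ) :
    NoEdgeCollision T (Msched m eu ev) := by
  rintro (u | r) (w | s) hne t - ⟨h₁, h₂, h₃⟩ <;>
    simp only [Msched, Sum.elim_inl, Sum.elim_inr] at h₁ h₂ h₃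
  · exact hne (congrArg Sum.inl (eq_of_Atraj_eq_Atraj h₁))
  · exact h₃ (Atraj_swap_Btraj_eq h₁ h₂)
  · exact h₃ (Atraj_swap_Btraj_eq h₂.symm h₁.symm).symm
  · have hr := (Btraj_succ_eq_or_mem_block eu ev r t).resolve_left
      fun h => h₃ (h.trans h₂).symm
    have hs := (Btraj_succ_eq_or_mem_block eu ev s t).resolve_left
      fun h => h₃ (h.trans h₁.symm)
    exact hne (congrArg Sum.inr (Fin.ext (by omega)))

/-- the constructed input schedule of the independent-set reduction is
feasible: it is `G`-valid and has no vertex and no edge collisions. -/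
theorem stmt_11 {U : Type*} [Fintype U] (m : ℕ) (hm : 1 ≤ m) (eu ev : Fin m → U)
    (huv : ∀ r, eu r ≠ ev r)
    (hinj : ∀ r s : Fin m,
      ((eu r = eu s ∧ ev r = ev s) ∨ (eu r = ev s ∧ ev r = eu s)) → r = s) :
    Feasible (RG m eu ev) (7 * m - 1) (Msched m eu ev) :=
  ⟨gValid_Msched m eu ev _, noVertexCollision_Msched m eu ev _,
    noEdgeCollision_Msched m eu ev _⟩
end

section
/- In the independent-set reduction with m ≥ 1 edges, suppose H has an independent set S ⊆ U with |S| ≥ K. Then there exists a schedule M', obtained from the constructed input schedule M by applying to each agent a sequence of collapses, such that M' is feasible and cost(M') ≤ cost(M) − 4m − 2K. -/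
section Reduction

variable {U : Type*} {m : ℕ}

/-- The trajectory that waits at `a_{e_r}` until time `s`, crosses `x_w` at time `s + 1`, and
waits at `b_{e_r}` afterwards. -/
def crossing (r : Fin m) (w : U) (s : ℕ) : ℕ → RV U m :=
  fun t => if t ≤ s then av r else if t = s + 1 then xv w else bv r

/-- The endpoint of edge `r` crossed by its edge-agent: `u_r` unless it lies in `S`. -/
noncomputable def crossedVertex (eu ev : Fin m → U) (S : Finset U) (r : Fin m) : U :=
  open Classical in if eu r ∈ S then ev r else eu r

/-- The time at which the edge-agent of edge `r` leaves `a_{e_r}` for its crossed endpoint. -/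
noncomputable def crossingStart (eu : Fin m → U) (S : Finset U) (r : Fin m) : ℕ :=
  open Classical in if eu r ∈ S then 7 * r + 4 else 7 * r

/-- The schedule in which the vertex-agents of `S` stay put and every edge-agent crosses exactly
one endpoint of its edge, outside `S`. -/
noncomputable def collapsedSchedule (eu ev : Fin m → U) (S : Finset U) :
    U ⊕ Fin m → ℕ → RV U m :=
  open Classical in
  Sum.elim (fun u => if u ∈ S then fun _ => xv u else Atraj m u)
    (fun r => crossing r (crossedVertex eu ev S r) (crossingStart eu S r))

theorem crossedVertex_notMem {eu ev : Fin m → U} {S : Finset U} {r : Fin m}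
    (hS : ¬(eu r ∈ S ∧ ev r ∈ S)) : crossedVertex eu ev S r ∉ S := by
  unfold crossedVertex
  split_ifs <;> tauto

theorem crossedVertex_eq_or (eu ev : Fin m → U) (S : Finset U) (r : Fin m) :
    crossedVertex eu ev S r = eu r ∨ crossedVertex eu ev S r = ev r := by
  unfold crossedVertex
  split_ifs <;> simp

theorem crossingStart_eq_or (eu : Fin m → U) (S : Finset U) (r : Fin m) :
    crossingStart eu S r = 7 * r ∨ crossingStart eu S r = 7 * r + 4 := by
  unfold crossingStart
  split_ifs <;> simp

theorem collapse_Atraj (hm : 1 ≤ m) (u : U) :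
    collapse (Atraj m u) 0 (7 * m - 1) = fun _ => xv u := by
  funext t
  simp only [collapse, Atraj]
  grind

theorem collapse_Btraj_fst (eu ev : Fin m → U) (r : Fin m) :
    collapse (Btraj eu ev r) (7 * r + 2) (7 * r + 6) = crossing r (eu r) (7 * r) := by
  funext t
  simp only [collapse, Btraj, crossing]
  grind

theorem collapse_Btraj_snd (eu ev : Fin m → U) (r : Fin m) :
    collapse (Btraj eu ev r) (7 * r) (7 * r + 4) = crossing r (ev r) (7 * r + 4) := by
  funext t
  simp only [collapse, Btraj, crossing]
  grind

theorem reflTransGen_collapsedSchedule (hm : 1 ≤ m) (eu ev : Fin m → U) (S : Finset U)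
    (i : U ⊕ Fin m) :
    Relation.ReflTransGen (CollapseStep (7 * m - 1))
      (Msched m eu ev i) (collapsedSchedule eu ev S i) := by
  rcases i with u | r
  · by_cases hu : u ∈ S
    · refine .single ⟨0, 7 * m - 1, by omega, le_rfl, ?_, ?_⟩
      · simp [Msched, Atraj]
      · simp [Msched, collapsedSchedule, hu, collapse_Atraj hm]
    · simpa [Msched, collapsedSchedule, hu] using Relation.ReflTransGen.refl
  · have hr := r.isLt
    by_cases hu : eu r ∈ S
    · refine .single ⟨7 * r, 7 * r + 4, by omega, by omega, ?_, ?_⟩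
      · simp [Msched, Btraj]
      · simp [Msched, collapsedSchedule, crossedVertex, crossingStart, hu, collapse_Btraj_snd]
    · refine .single ⟨7 * r + 2, 7 * r + 6, by omega, by omega, ?_, ?_⟩
      · simp [Msched, Btraj]
      · simp [Msched, collapsedSchedule, crossedVertex, crossingStart, hu, collapse_Btraj_fst]

theorem RG_adj_xv_pv (eu ev : Fin m → U) (u : U) : (RG m eu ev).Adj (xv u) (pv u) := by
  refine (SimpleGraph.fromRel_adj _ _ _).2 ⟨by simp [xv, pv], .inl (.inl ⟨u, rfl, rfl⟩)⟩

theorem RG_adj_av_xv {eu ev : Fin m → U} {r : Fin m} {w : U} (hw : w = eu r ∨ w = ev r) :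
    (RG m eu ev).Adj (av r) (xv w) := by
  refine (SimpleGraph.fromRel_adj _ _ _).2 ⟨by simp [xv, av], .inl (.inr ⟨r, ?_⟩)⟩
  rcases hw with rfl | rfl <;> simp

theorem RG_adj_xv_bv {eu ev : Fin m → U} {r : Fin m} {w : U} (hw : w = eu r ∨ w = ev r) :
    (RG m eu ev).Adj (xv w) (bv r) := by
  refine (SimpleGraph.fromRel_adj _ _ _).2 ⟨by simp [xv, bv], .inl (.inr ⟨r, ?_⟩)⟩
  rcases hw with rfl | rfl <;> simp

theorem gValid_collapsedSchedule (eu ev : Fin m → U) (S : Finset U) (T : ℕ) :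
    GValid (RG m eu ev) T (collapsedSchedule eu ev S) := by
  rintro (u | r) t -
  · have h := RG_adj_xv_pv eu ev u
    have h' := h.symm
    by_cases hu : u ∈ S
    · simp [collapsedSchedule, hu]
    · simp only [collapsedSchedule, hu, Sum.elim_inl, if_false, Atraj]
      grind
  · have ha := RG_adj_av_xv (crossedVertex_eq_or eu ev S r)
    have hb := RG_adj_xv_bv (crossedVertex_eq_or eu ev S r)
    simp only [collapsedSchedule, Sum.elim_inr, crossing]
    grind

theorem collapsedSchedule_inl_cases (eu ev : Fin m → U) (S : Finset U) (u : U) (t : ℕ) :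
    (collapsedSchedule eu ev S (.inl u) t = xv u ∧ (u ∈ S ∨ t = 0 ∨ 7 * m - 1 ≤ t)) ∨
      collapsedSchedule eu ev S (.inl u) t = pv u := by
  by_cases hu : u ∈ S
  · simp [collapsedSchedule, hu]
  · simp only [collapsedSchedule, hu, Sum.elim_inl, if_false, Atraj]
    grind

theorem collapsedSchedule_inr_cases (eu ev : Fin m → U) (S : Finset U) (r : Fin m) (t : ℕ) :
    collapsedSchedule eu ev S (.inr r) t = av r ∨ collapsedSchedule eu ev S (.inr r) t = bv r ∨
      (collapsedSchedule eu ev S (.inr r) t = xv (crossedVertex eu ev S r) ∧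
        t = crossingStart eu S r + 1) := by
  simp only [collapsedSchedule, Sum.elim_inr, crossing]
  grind

theorem noVertexCollision_collapsedSchedule {eu ev : Fin m → U} {S : Finset U}
    (hS : ∀ r, ¬(eu r ∈ S ∧ ev r ∈ S)) :
    NoVertexCollision (7 * m - 1) (collapsedSchedule eu ev S) := by
  have key : ∀ u r t,
      collapsedSchedule eu ev S (.inl u) t ≠ collapsedSchedule eu ev S (.inr r) t := by
    intro u r t
    have hw := crossedVertex_notMem (hS r)
    have hs := crossingStart_eq_or eu S r
    have hr := r.isLt
    rcases collapsedSchedule_inl_cases eu ev S u t with ⟨hA, h⟩ | hA <;>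
      rcases collapsedSchedule_inr_cases eu ev S r t with hB | hB | ⟨hB, ht⟩ <;>
      rw [hA, hB] <;> simp only [xv, pv, av, bv, ne_eq, Sum.inl.injEq, reduceCtorEq,
        not_false_eq_true]
    rintro rfl
    rcases h with h | h | h
    · exact hw h
    all_goals omega
  rintro (u | r) (v | s) hij t -
  · have huv : u ≠ v := fun h => hij (h ▸ rfl)
    rcases collapsedSchedule_inl_cases eu ev S u t with ⟨hA, -⟩ | hA <;>
      rcases collapsedSchedule_inl_cases eu ev S v t with ⟨hB, -⟩ | hB <;>
      rw [hA, hB] <;> simp [xv, pv, huv]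
  · exact key u s t
  · exact (key v r t).symm
  · have hrs : r ≠ s := fun h => hij (h ▸ rfl)
    have hrs' : (r : ℕ) ≠ s := fun h => hrs (Fin.ext h)
    have hr := crossingStart_eq_or eu S r
    have hs := crossingStart_eq_or eu S s
    rcases collapsedSchedule_inr_cases eu ev S r t with hA | hA | ⟨hA, ht⟩ <;>
      rcases collapsedSchedule_inr_cases eu ev S s t with hB | hB | ⟨hB, ht'⟩ <;>
      first
        | omega
        | rw [hA, hB]; simp [xv, av, bv, hrs]

/-- Every move of an agent starts or ends at a vertex that no other agent ever visits. -/
theorem collapsedSchedule_move_private (eu ev : Fin m → U) (S : Finset U) {i j : U ⊕ Fin m}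
    (hij : i ≠ j) {t : ℕ}
    (h : collapsedSchedule eu ev S i t ≠ collapsedSchedule eu ev S i (t + 1)) :
    (∀ t', collapsedSchedule eu ev S j t' ≠ collapsedSchedule eu ev S i t) ∨
      ∀ t', collapsedSchedule eu ev S j t' ≠ collapsedSchedule eu ev S i (t + 1) := by
  rcases i with u | r
  · have hp : ∀ t', collapsedSchedule eu ev S j t' ≠ pv u := by
      intro t'
      rcases j with v | s
      · have huv : v ≠ u := fun h => hij (h ▸ rfl)
        rcases collapsedSchedule_inl_cases eu ev S v t' with ⟨hA, -⟩ | hA <;>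
          rw [hA] <;> simp [xv, pv, huv]
      · rcases collapsedSchedule_inr_cases eu ev S s t' with hA | hA | ⟨hA, -⟩ <;>
          rw [hA] <;> simp [xv, pv, av, bv]
    rcases collapsedSchedule_inl_cases eu ev S u t with ⟨hA, -⟩ | hA
    · rcases collapsedSchedule_inl_cases eu ev S u (t + 1) with ⟨hB, -⟩ | hB
      · exact absurd (hA.trans hB.symm) h
      · exact .inr (hB ▸ hp)
    · exact .inl (hA ▸ hp)
  · have hp : ∀ t', collapsedSchedule eu ev S j t' ≠ av r ∧
        collapsedSchedule eu ev S j t' ≠ bv r := by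
      intro t'
      rcases j with v | s
      · rcases collapsedSchedule_inl_cases eu ev S v t' with ⟨hA, -⟩ | hA <;>
          rw [hA] <;> simp [xv, pv, av, bv]
      · have hrs : s ≠ r := fun h => hij (h ▸ rfl)
        rcases collapsedSchedule_inr_cases eu ev S s t' with hA | hA | ⟨hA, -⟩ <;>
          rw [hA] <;> simp [xv, av, bv, hrs]
    rcases collapsedSchedule_inr_cases eu ev S r t with hA | hA | ⟨hA, ht⟩
    · exact .inl fun t' => hA ▸ (hp t').1
    · exact .inl fun t' => hA ▸ (hp t').2
    · rcases collapsedSchedule_inr_cases eu ev S r (t + 1) with hB | hB | ⟨hB, ht'⟩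
      · exact .inr fun t' => hB ▸ (hp t').1
      · exact .inr fun t' => hB ▸ (hp t').2
      · omega

theorem noEdgeCollision_collapsedSchedule (eu ev : Fin m → U) (S : Finset U) (T : ℕ) :
    NoEdgeCollision T (collapsedSchedule eu ev S) := by
  rintro i j hij t - ⟨h₁, h₂, h₃⟩
  have hmove : collapsedSchedule eu ev S i t ≠ collapsedSchedule eu ev S i (t + 1) :=
    fun h => h₃ (h₂ ▸ h.symm)
  rcases collapsedSchedule_move_private eu ev S hij hmove with h | h
  · exact h (t + 1) h₁.symm
  · exact h t h₂.symm

theorem card_le_cost {V : Type*} {π : ℕ → V} {T : ℕ} (s : Finset ℕ)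
    (hs : ∀ t ∈ s, t < T ∧ π t ≠ π (t + 1)) : s.card ≤ cost π T := by
  rw [← Set.ncard_coe_finset]
  exact Set.ncard_le_ncard (fun t ht => hs t ht) ((Set.finite_lt_nat T).subset fun _ h => h.1)

theorem cost_le_card {V : Type*} {π : ℕ → V} {T : ℕ} (s : Finset ℕ)
    (hs : ∀ t, π t ≠ π (t + 1) → t ∈ s) : cost π T ≤ s.card := by
  rw [← Set.ncard_coe_finset]
  exact Set.ncard_le_ncard (fun t ht => hs t ht.2) s.finite_toSet

theorem cost_crossing_le (r : Fin m) (w : U) (s T : ℕ) : cost (crossing r w s) T ≤ 2 := by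
  refine (cost_le_card {s, s + 1} fun t ht => ?_).trans Finset.card_le_two
  simp only [Finset.mem_insert, Finset.mem_singleton]
  simp only [crossing] at ht
  grind

theorem six_le_cost_Btraj (eu ev : Fin m → U) (r : Fin m) :
    6 ≤ cost (Btraj eu ev r) (7 * m - 1) := by
  have hr := r.isLt
  have h := card_le_cost (π := Btraj eu ev r) (T := 7 * m - 1)
    (Finset.Ico (7 * (r : ℕ)) (7 * r + 6)) ?_
  · simpa using h
  · intro t ht
    obtain ⟨k, rfl⟩ := Nat.exists_eq_add_of_le (Finset.mem_Ico.1 ht).1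
    have hk : k < 6 := by have := (Finset.mem_Ico.1 ht).2; omega
    refine ⟨by omega, ?_⟩
    interval_cases k <;> simp [Btraj, xv, av, bv, cv]

theorem two_le_cost_Atraj (hm : 1 ≤ m) (u : U) : 2 ≤ cost (Atraj m u) (7 * m - 1) := by
  have h := card_le_cost (π := Atraj m u) (T := 7 * m - 1) {0, 7 * m - 2} ?_
  · rwa [Finset.card_pair (by omega)] at h
  · have hxp : (xv u : RV U m) ≠ pv u := by simp [xv, pv]
    simp only [Finset.mem_insert, Finset.mem_singleton, Atraj]
    grind

theorem cost_collapsedSchedule_inl_add_le (hm : 1 ≤ m) (eu ev : Fin m → U) (S : Finset U)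
    (u : U) [Decidable (u ∈ S)] :
    cost (collapsedSchedule eu ev S (.inl u)) (7 * m - 1) + (if u ∈ S then 2 else 0) ≤
      cost (Atraj m u) (7 * m - 1) := by
  by_cases hu : u ∈ S
  · have := two_le_cost_Atraj hm u
    simpa [collapsedSchedule, hu, cost] using this
  · simp [collapsedSchedule, hu]

theorem scheduleCost_collapsedSchedule_add_le [Fintype U] (hm : 1 ≤ m) (eu ev : Fin m → U)
    (S : Finset U) :
    scheduleCost (collapsedSchedule eu ev S) (7 * m - 1) + (4 * m + 2 * S.card) ≤
      scheduleCost (Msched m eu ev) (7 * m - 1) := by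
  classical
  have hA := Finset.sum_le_sum fun u (_ : u ∈ Finset.univ) =>
    cost_collapsedSchedule_inl_add_le hm eu ev S u
  have hB : ∑ r, (cost (collapsedSchedule eu ev S (.inr r)) (7 * m - 1) + 4) ≤
      ∑ r, cost (Btraj eu ev r) (7 * m - 1) := by
    refine Finset.sum_le_sum fun r _ => ?_
    have h₁ := six_le_cost_Btraj eu ev r
    have h₂ := cost_crossing_le r (crossedVertex eu ev S r) (crossingStart eu S r) (7 * m - 1)
    simp only [collapsedSchedule, Sum.elim_inr]
    omega
  simp only [Finset.sum_add_distrib, Finset.sum_ite_mem, Finset.univ_inter, Finset.sum_const,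
    Finset.card_univ, Fintype.card_fin, smul_eq_mul] at hA hB
  simp only [scheduleCost, Fintype.sum_sum_type, Msched, Sum.elim_inl, Sum.elim_inr]
  omega

end Reduction

/-- if `H` has an independent set `S` with `|S| ≥ K`, then some schedule
`M'` obtained from the constructed input schedule by applying to each agent a sequence
of collapses is feasible and satisfies `cost(M') ≤ cost(M) − 4m − 2K`. -/
theorem stmt_13 {U : Type*} [Fintype U] (m : ℕ) (hm : 1 ≤ m) (eu ev : Fin m → U)
    (huv : ∀ r, eu r ≠ ev r)
    (hinj : ∀ r s : Fin m,
      ((eu r = eu s ∧ ev r = ev s) ∨ (eu r = ev s ∧ ev r = eu s)) → r = s)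
    (K : ℕ) (S : Finset U)
    (hSind : ∀ r : Fin m, ¬(eu r ∈ S ∧ ev r ∈ S)) (hSK : K ≤ S.card) :
    ∃ M' : (U ⊕ Fin m) → ℕ → RV U m,
      (∀ i, Relation.ReflTransGen (CollapseStep (7 * m - 1))
          (Msched m eu ev i) (M' i)) ∧
      Feasible (RG m eu ev) (7 * m - 1) M' ∧
      scheduleCost M' (7 * m - 1) + (4 * m + 2 * K)
        ≤ scheduleCost (Msched m eu ev) (7 * m - 1) := by
  refine ⟨collapsedSchedule eu ev S, reflTransGen_collapsedSchedule hm eu ev S,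
    ⟨gValid_collapsedSchedule eu ev S _, noVertexCollision_collapsedSchedule hSind,
      noEdgeCollision_collapsedSchedule eu ev S _⟩, ?_⟩
  have h := scheduleCost_collapsedSchedule_add_le hm eu ev S
  omega
end

section
/- In the independent-set reduction with m ≥ 1 edges, let M' be any feasible schedule obtained from the constructed input schedule M by applying to each agent a sequence of collapses, and let S be the set of vertices u ∈ U whose vertex-agent trajectory in M' is the constant trajectory at x_u. Then S is an independent set of H: for every edge e_r ∈ F with endpoints u_r and v_r, not both u_r ∈ S and v_r ∈ S. -/
/-- The collapse of a closed subwalk `[a, b]` agrees with the trajectory outside `(a, b)`. -/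
lemma collapse_eq_of_le_or_le {V : Type*} {π : ℕ → V} {a b t : ℕ} (hπ : π a = π b)
    (ht : t ≤ a ∨ b ≤ t) : collapse π a b t = π t := by
  unfold collapse
  split_ifs with h
  · rcases ht with ht | ht
    · rw [le_antisymm ht h.1]
    · rw [le_antisymm h.2 ht, hπ]
  · rfl

/-- Collapsing a closed subwalk preserves every reflexive relation between consecutive
positions. -/
lemma CollapseStep.rel_succ {V : Type*} {T : ℕ} {π π' : ℕ → V} {R : V → V → Prop}
    (hR : ∀ v, R v v) (h : CollapseStep T π π') (hπ : ∀ t, R (π t) (π (t + 1))) (t : ℕ) :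
    R (π' t) (π' (t + 1)) := by
  obtain ⟨a, b, -, -, hab, rfl⟩ := h
  by_cases ht : a ≤ t ∧ t + 1 ≤ b
  · have h₁ : collapse π a b t = π a := if_pos (by omega)
    have h₂ : collapse π a b (t + 1) = π a := if_pos (by omega)
    rw [h₁, h₂]
    exact hR _
  · rw [collapse_eq_of_le_or_le hab (by omega), collapse_eq_of_le_or_le hab (by omega)]
    exact hπ t

/-- A sequence of collapses keeps the endpoints of a trajectory and every reflexive relation
between its consecutive positions. -/
lemma reflTransGen_collapseStep_invariant_s16 {V : Type*} {T : ℕ} {π π' : ℕ → V} {R : V → V → Prop}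
    (hR : ∀ v, R v v) (h : Relation.ReflTransGen (CollapseStep T) π π')
    (hπ : ∀ t, R (π t) (π (t + 1))) :
    π' 0 = π 0 ∧ π' T = π T ∧ ∀ t, R (π' t) (π' (t + 1)) := by
  induction h with
  | refl => exact ⟨rfl, rfl, hπ⟩
  | tail _ hstep ih =>
    obtain ⟨h0, hT, hrel⟩ := ih
    refine ⟨?_, ?_, hstep.rel_succ hR hrel⟩ <;> obtain ⟨a, b, -, hbT, hab, rfl⟩ := hstep
    · rw [collapse_eq_of_le_or_le hab (Or.inl (Nat.zero_le _)), h0]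
    · rw [collapse_eq_of_le_or_le hab (Or.inr hbT), hT]

/-- From `a_{e_r}`, the edge-agent only waits or moves to one of the endpoint vertices. -/
lemma Btraj_succ_of_eq_av {U : Type*} {m : ℕ} (eu ev : Fin m → U) (r : Fin m) (t : ℕ)
    (h : Btraj eu ev r t = av r) :
    Btraj eu ev r (t + 1) = av r ∨ Btraj eu ev r (t + 1) = xv (eu r) ∨
      Btraj eu ev r (t + 1) = xv (ev r) := by
  have ht : t ≤ 7 * (r : ℕ) ∨ t = 7 * (r : ℕ) + 4 := by
    by_contra! hne
    unfold Btraj at h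
    split_ifs at h <;> first | omega | simp [av, bv, cv, xv] at h
  unfold Btraj
  split_ifs <;> first | omega | simp

/-- Every trajectory obtained from an edge-agent by collapses visits an endpoint of its edge. -/
lemma exists_eq_xv_of_reflTransGen_Btraj {U : Type*} {m : ℕ} (eu ev : Fin m → U) (r : Fin m)
    {π : ℕ → RV U m}
    (h : Relation.ReflTransGen (CollapseStep (7 * m - 1)) (Btraj eu ev r) π) :
    ∃ t ≤ 7 * m - 1, π t = xv (eu r) ∨ π t = xv (ev r) := by
  obtain ⟨h0, hT, hrel⟩ := reflTransGen_collapseStep_invariant_s16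
    (R := fun w z => w = av r → z = av r ∨ z = xv (eu r) ∨ z = xv (ev r))
    (fun _ hv => Or.inl hv) h (Btraj_succ_of_eq_av eu ev r)
  by_contra! hne
  have hstay : ∀ t ≤ 7 * m - 1, π t = av r := by
    intro t
    induction t with
    | zero => exact fun _ => h0.trans (if_pos (Nat.zero_le _))
    | succ t ih =>
      intro ht
      rcases hrel t (ih (by omega)) with h' | h' | h'
      · exact h'
      · exact absurd h' (hne _ ht).1
      · exact absurd h' (hne _ ht).2
  have hend : Btraj eu ev r (7 * m - 1) = bv r := by
    have := r.isLt
    unfold Btraj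
    split_ifs <;> first | omega | rfl
  have hab : (av r : RV U m) = bv r := (hstay _ le_rfl).symm.trans (hT.trans hend)
  simp [av, bv] at hab

/-- for any feasible schedule `M'` obtained from the constructed input
schedule by per-agent sequences of collapses, the set of vertices `u` whose
vertex-agent trajectory in `M'` is the constant trajectory at `x_u` is an independent
set of `H`. -/
theorem stmt_16 {U : Type*} [Fintype U] (m : ℕ) (hm : 1 ≤ m) (eu ev : Fin m → U)
    (huv : ∀ r, eu r ≠ ev r)
    (hinj : ∀ r s : Fin m,
      ((eu r = eu s ∧ ev r = ev s) ∨ (eu r = ev s ∧ ev r = eu s)) → r = s)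
    (M' : (U ⊕ Fin m) → ℕ → RV U m)
    (hreach : ∀ i, Relation.ReflTransGen (CollapseStep (7 * m - 1))
        (Msched m eu ev i) (M' i))
    (hfeas : Feasible (RG m eu ev) (7 * m - 1) M') :
    ∀ r : Fin m,
      ¬(eu r ∈ {u : U | ∀ t ≤ 7 * m - 1, M' (Sum.inl u) t = xv u} ∧
        ev r ∈ {u : U | ∀ t ≤ 7 * m - 1, M' (Sum.inl u) t = xv u}) := by
  rintro r ⟨hu, hv⟩
  obtain ⟨t, ht, h | h⟩ := exists_eq_xv_of_reflTransGen_Btraj eu ev r (hreach (Sum.inr r))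
  · exact hfeas.2.1 _ _ Sum.inl_ne_inr t ht ((hu t ht).trans h.symm)
  · exact hfeas.2.1 _ _ Sum.inl_ne_inr t ht ((hv t ht).trans h.symm)
end
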